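/- For all κ₁ > 0 and κ₂ ∈ (0,1) there exist constants c > 0 and C > 0 (depending only on κ₁, κ₂) such that for all real x ≥ y ≥ 2, every integer n ∈ S(x,y) satisfying n ≥ √x, ω̃_{x,y}(n) ≥ κ₁·ū, κ₂ ≤ m_{2,n}·ū/(log x)² ≤ 1/κ₂ and κ₂/ū ≤ m_{4,n}·ū³/(log x)⁴ ≤ 1/κ₂, and every z with 0 ≤ z ≤ c·√ū, one has |β_n(z) − z/σ_n| ≤ C·(z/σ_n)·z²/w_n and |φ_n''(β_n(z)) − σ_n²| ≤ C·σ_n²·z²/w_n. -/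

import Mathlib

open Finset MeasureTheory
open scoped Classical

noncomputable section

/-- The set of primes `p ≤ y`. -/
def primesUpTo (y : ℝ) : Finset ℕ := (Finset.range (⌊y⌋₊ + 1)).filter Nat.Prime

/-- `S(x,y)`: the set of `y`-friable integers in `[1,x]`. -/
def Sf (x y : ℝ) : Finset ℕ :=
  (Finset.Icc 1 ⌊x⌋₊).filter fun n => ∀ p : ℕ, p.Prime → p ∣ n → (p : ℝ) ≤ y

/-- `Ψ(x,y)`. -/
def Psi (x y : ℝ) : ℝ := (Sf x y).card

/-- `u = log x / log y`. -/
def uQ (x y : ℝ) : ℝ := Real.log x / Real.log y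

/-- `ū = min(u, π(y))`. -/
def ubar (x y : ℝ) : ℝ := min (uQ x y) ((primesUpTo y).card)

/-- `ν_{x,y}(A) = |A ∩ S(x,y)| / Ψ(x,y)`. -/
def nuMeas (x y : ℝ) (A : Set ℕ) : ℝ :=
  (((Sf x y).filter fun n => n ∈ A).card : ℝ) / Psi x y

/-- `P(D_n ≥ t) = #{d ∣ n : log d ≥ t} / τ(n)`. -/
def DnProb (n : ℕ) (t : ℝ) : ℝ :=
  ((n.divisors.filter fun d => t ≤ Real.log d).card : ℝ) / (n.divisors.card : ℝ)

/-- `m_{2,n}`. -/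
def m2 (n : ℕ) : ℝ :=
  (1 / 12) * ∑ p ∈ n.primeFactors,
    (n.factorization p : ℝ) * ((n.factorization p : ℝ) + 2) * Real.log p ^ 2

/-- `m_{4,n}`. -/
def m4 (n : ℕ) : ℝ :=
  (1 / 240) * ∑ p ∈ n.primeFactors,
    (n.factorization p : ℝ) * ((n.factorization p : ℝ) + 2) *
      (3 * (n.factorization p : ℝ) ^ 2 + 6 * (n.factorization p : ℝ) - 4) * Real.log p ^ 4

/-- `σ_n = √(m_{2,n})`. -/
def sigman (n : ℕ) : ℝ := Real.sqrt (m2 n)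

/-- `w_n = m_{2,n}² / m_{4,n}`, with `w_1 = 1`. -/
def wn (n : ℕ) : ℝ := if n = 1 then 1 else m2 n ^ 2 / m4 n

/-- `Φ(z) = (1/√(2π)) ∫_z^∞ e^{-t²/2} dt`. -/
def GaussPhi (z : ℝ) : ℝ :=
  (1 / Real.sqrt (2 * Real.pi)) * ∫ t in Set.Ioi z, Real.exp (-t ^ 2 / 2)

/-- `ω̃_{x,y}(n)`. -/
def omegaTilde (x y : ℝ) (n : ℕ) : ℕ :=
  ((n.primeFactors).filter fun p : ℕ =>
    Real.sqrt y < (p : ℝ) ∧ (p : ℝ) ≤ y ∧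
      uQ x y / (2 * ubar x y) ≤ (n.factorization p : ℝ) ∧
      (n.factorization p : ℝ) ≤ 2 * uQ x y / ubar x y).card

/-- The saddle-point equation defining `α(x,y)`. -/
def saddleEq (x y α : ℝ) : Prop :=
  ∑ p ∈ primesUpTo y, Real.log p / ((p : ℝ) ^ α - 1) = Real.log x

/-- `σ̄(x,y)` (in terms of `y` and `α`). -/
def sigmaBar (y α : ℝ) : ℝ :=
  Real.sqrt ((1 / 2) * ∑ p ∈ primesUpTo y,
    ((p : ℝ) ^ α - 1 / 3) * Real.log p ^ 2 / ((p : ℝ) ^ α - 1) ^ 2)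

/-- `ζ(α,y)`. -/
def zetaY (y α : ℝ) : ℝ := ∏ p ∈ primesUpTo y, (1 - (p : ℝ) ^ (-α))⁻¹

/-- `f_k(n) = ∑_{p^ν ‖ n} (ν log p)^k`. -/
def fk (k : ℕ) (n : ℕ) : ℝ :=
  ∑ p ∈ n.primeFactors, ((n.factorization p : ℝ) * Real.log p) ^ k

/-- `A_f(x,y) = ∑_{p ≤ y} ∑_{ν ≥ 1} f(p^ν) p^{-να} (1 - p^{-α})`. -/
def Af (y α : ℝ) (f : ℕ → ℝ) : ℝ :=
  ∑ p ∈ primesUpTo y, ∑' ν : ℕ,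
    f (p ^ (ν + 1)) * (p : ℝ) ^ (-(((ν : ℝ) + 1) * α)) * (1 - (p : ℝ) ^ (-α))

/-- `Z_n(β)` for real `β` (each Euler factor written as the everywhere-defined mean
`(1/(ν+1)) ∑_{0 ≤ j ≤ ν} p^{jβ}`, which is the continuous extension of
`(p^{(ν+1)β}-1)/((ν+1)(p^β-1))`). -/
def ZnR (n : ℕ) (β : ℝ) : ℝ :=
  ∏ p ∈ n.primeFactors,
    (∑ j ∈ Finset.range (n.factorization p + 1), (p : ℝ) ^ ((j : ℝ) * β)) /
      ((n.factorization p : ℝ) + 1)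

/-- `φ_n = log Z_n` on the reals. -/
def phiN (n : ℕ) (β : ℝ) : ℝ := Real.log (ZnR n β)

/-- `Z_n(s)` for complex `s`. -/
def ZnC (n : ℕ) (s : ℂ) : ℂ :=
  ∏ p ∈ n.primeFactors,
    (∑ j ∈ Finset.range (n.factorization p + 1), (p : ℂ) ^ ((j : ℂ) * s)) /
      ((n.factorization p : ℂ) + 1)

/-- Distance from `θ` to the nearest integer. -/
def nid (θ : ℝ) : ℝ := |θ - round θ|

/-- `V_y(s) = (y^{1-s} - 1)/(1 - s)`, extended by continuity at `s = 1`. -/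
def Vy (y : ℝ) (s : ℂ) : ℂ :=
  if s = 1 then (Real.log y : ℂ) else (((y : ℝ) : ℂ) ^ (1 - s) - 1) / (1 - s)

lemma abs_sinh_le_abs_mul_cosh (x : ℝ) : |Real.sinh x| ≤ |x| * Real.cosh x := by
  have key : ∀ t : ℝ, 0 ≤ t → Real.sinh t ≤ t * Real.cosh t := by
    have hd : ∀ t : ℝ, HasDerivAt (fun t => t * Real.cosh t - Real.sinh t)
        (t * Real.sinh t) t := fun t => by
      have h := ((hasDerivAt_id t).mul (Real.hasDerivAt_cosh t)).sub (Real.hasDerivAt_sinh t)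
      exact h.congr_deriv (by simp)
    have hm : MonotoneOn (fun t => t * Real.cosh t - Real.sinh t) (Set.Ici (0 : ℝ)) := by
      refine monotoneOn_of_deriv_nonneg (convex_Ici 0)
        (fun t _ => (hd t).continuousAt.continuousWithinAt)
        (fun t _ => (hd t).differentiableAt.differentiableWithinAt) fun t ht => ?_
      rw [interior_Ici] at ht
      rw [(hd t).deriv]
      exact mul_nonneg ht.le (Real.sinh_nonneg_iff.2 ht.le)
    intro t ht
    have := hm (Set.mem_Ici.2 le_rfl) (Set.mem_Ici.2 ht) ht
    simp at this
    linarith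
  rw [Real.abs_sinh, ← Real.cosh_abs x]
  exact key _ (abs_nonneg x)

lemma cosh_sub_one_le (x : ℝ) : Real.cosh x - 1 ≤ x ^ 2 / 2 * Real.cosh x := by
  have h1 : Real.cosh x = Real.cosh (x / 2) ^ 2 + Real.sinh (x / 2) ^ 2 := by
    rw [← Real.cosh_two_mul]; ring_nf
  have h2 := Real.cosh_sq (x / 2)
  have h3 : Real.sinh (x / 2) ^ 2 ≤ (x / 2) ^ 2 * Real.cosh (x / 2) ^ 2 := by
    rw [← mul_pow]
    apply sq_le_sq.2
    rw [abs_mul, abs_of_pos (Real.cosh_pos _)]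
    exact abs_sinh_le_abs_mul_cosh _
  nlinarith [Real.one_le_cosh x, sq_nonneg x]

section CoshSum

variable {ι : Type*} (s : Finset ι) (a : ι → ℝ)

/-- The second logarithmic derivative of `t ↦ ∑ i ∈ s, cosh (a i * t)`. -/
def coshSumVar (t : ℝ) : ℝ :=
  (∑ i ∈ s, a i ^ 2 * Real.cosh (a i * t)) / (∑ i ∈ s, Real.cosh (a i * t)) -
    ((∑ i ∈ s, a i * Real.sinh (a i * t)) / ∑ i ∈ s, Real.cosh (a i * t)) ^ 2

lemma sum_cosh_pos {s : Finset ι} (hs : s.Nonempty) (t : ℝ) :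
    0 < ∑ i ∈ s, Real.cosh (a i * t) :=
  Finset.sum_pos (fun _ _ => Real.cosh_pos _) hs

lemma hasDerivAt_sum_cosh (t : ℝ) :
    HasDerivAt (fun t => ∑ i ∈ s, Real.cosh (a i * t)) (∑ i ∈ s, a i * Real.sinh (a i * t)) t := by
  refine HasDerivAt.fun_sum fun i _ => ?_
  have h := ((hasDerivAt_id t).const_mul (a i)).cosh
  simpa [mul_comm] using h

lemma hasDerivAt_sum_mul_sinh (t : ℝ) :
    HasDerivAt (fun t => ∑ i ∈ s, a i * Real.sinh (a i * t))
      (∑ i ∈ s, a i ^ 2 * Real.cosh (a i * t)) t := by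
  refine HasDerivAt.fun_sum fun i _ => ?_
  have h := (((hasDerivAt_id t).const_mul (a i)).sinh).const_mul (a i)
  exact h.congr_deriv (by simp; ring)

lemma hasDerivAt_log_sum_cosh {s : Finset ι} (hs : s.Nonempty) (t : ℝ) :
    HasDerivAt (fun t => Real.log (∑ i ∈ s, Real.cosh (a i * t)))
      ((∑ i ∈ s, a i * Real.sinh (a i * t)) / ∑ i ∈ s, Real.cosh (a i * t)) t :=
  (hasDerivAt_sum_cosh s a t).log (sum_cosh_pos a hs t).ne'

lemma hasDerivAt_sinh_div_cosh {s : Finset ι} (hs : s.Nonempty) (t : ℝ) :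
    HasDerivAt (fun t => (∑ i ∈ s, a i * Real.sinh (a i * t)) / ∑ i ∈ s, Real.cosh (a i * t))
      (coshSumVar s a t) t := by
  have hC := (sum_cosh_pos a hs t).ne'
  refine ((hasDerivAt_sum_mul_sinh s a t).div (hasDerivAt_sum_cosh s a t) hC).congr_deriv ?_
  rw [coshSumVar, sub_div, sq (_ / _), div_mul_div_comm, sq (∑ i ∈ s, Real.cosh (a i * t)),
    mul_div_mul_right _ _ hC]

lemma coshSumVar_nonneg {s : Finset ι} (hs : s.Nonempty) (t : ℝ) : 0 ≤ coshSumVar s a t := by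
  have hC := sum_cosh_pos a hs t
  have h : (∑ i ∈ s, a i * Real.sinh (a i * t)) ^ 2 ≤
      (∑ i ∈ s, a i ^ 2 * Real.cosh (a i * t)) * ∑ i ∈ s, Real.cosh (a i * t) := by
    refine Finset.sum_sq_le_sum_mul_sum_of_sq_le_mul s
      (fun i _ => mul_nonneg (sq_nonneg _) (Real.cosh_pos _).le)
      (fun i _ => (Real.cosh_pos _).le) fun i _ => ?_
    have := Real.cosh_sq (a i * t)
    nlinarith [sq_nonneg (a i)]
  rw [coshSumVar, sub_nonneg, div_pow, div_le_div_iff₀ (by positivity) hC]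
  nlinarith

lemma abs_coshSumVar_sub_le {s : Finset ι} (hs : s.Nonempty) {A : ℝ} (hA : ∀ i ∈ s, |a i| ≤ A)
    (t : ℝ) :
    |coshSumVar s a t - (∑ i ∈ s, a i ^ 2) / s.card| ≤ 2 * A ^ 4 * t ^ 2 := by
  have hA2 : ∀ i ∈ s, a i ^ 2 ≤ A ^ 2 := fun i hi => by
    rw [← sq_abs]; exact pow_le_pow_left₀ (abs_nonneg _) (hA i hi) 2
  have hN : (0 : ℝ) < s.card := by exact_mod_cast hs.card_pos
  have hC := sum_cosh_pos a hs t
  set C := ∑ i ∈ s, Real.cosh (a i * t) with hCdef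
  set D := ∑ i ∈ s, a i * Real.sinh (a i * t) with hDdef
  set E := ∑ i ∈ s, a i ^ 2 * Real.cosh (a i * t) with hEdef
  set F := ∑ i ∈ s, a i ^ 2 with hFdef
  have hterm : ∀ i ∈ s, Real.cosh (a i * t) - 1 ≤ A ^ 2 * t ^ 2 / 2 * Real.cosh (a i * t) := by
    intro i hi
    refine (cosh_sub_one_le _).trans ?_
    have := Real.cosh_pos (a i * t)
    rw [mul_pow]
    have := hA2 i hi
    gcongr ?_ * _ / _ * _
  have hDC : |D| ≤ A ^ 2 * |t| * C := by
    rw [hDdef, hCdef, Finset.mul_sum]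
    refine (Finset.abs_sum_le_sum_abs _ _).trans (Finset.sum_le_sum fun i hi => ?_)
    rw [abs_mul]
    have h1 := abs_sinh_le_abs_mul_cosh (a i * t)
    rw [abs_mul] at h1
    have h2 := Real.cosh_pos (a i * t)
    calc |a i| * |Real.sinh (a i * t)| ≤ |a i| * (|a i| * |t| * Real.cosh (a i * t)) := by gcongr
      _ = a i ^ 2 * |t| * Real.cosh (a i * t) := by rw [← sq_abs (a i)]; ring
      _ ≤ _ := by
        have := hA2 i hi
        gcongr ?_ * _ * _
  have hD2 : (D / C) ^ 2 ≤ A ^ 4 * t ^ 2 := by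
    rw [div_pow, div_le_iff₀ (by positivity), ← sq_abs D]
    calc |D| ^ 2 ≤ (A ^ 2 * |t| * C) ^ 2 := pow_le_pow_left₀ (abs_nonneg _) hDC 2
      _ = A ^ 4 * t ^ 2 * C ^ 2 := by rw [mul_pow, mul_pow, sq_abs]; ring
  have hCN : C - s.card ≤ A ^ 2 * t ^ 2 / 2 * C := by
    have h := Finset.sum_le_sum hterm
    rw [← Finset.mul_sum, Finset.sum_sub_distrib] at h
    simpa using h
  have hCN0 : 0 ≤ C - s.card := by
    have h := Finset.sum_le_sum fun i (_ : i ∈ s) => Real.one_le_cosh (a i * t)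
    simp only [Finset.sum_const, nsmul_eq_mul, mul_one] at h
    linarith
  have hEF : E - F ≤ A ^ 2 * (A ^ 2 * t ^ 2 / 2 * C) := by
    rw [hEdef, hFdef, hCdef, ← Finset.sum_sub_distrib, Finset.mul_sum, Finset.mul_sum]
    refine Finset.sum_le_sum fun i hi => ?_
    have h1 := hterm i hi
    have h2 := Real.one_le_cosh (a i * t)
    calc a i ^ 2 * Real.cosh (a i * t) - a i ^ 2 = a i ^ 2 * (Real.cosh (a i * t) - 1) := by ring
      _ ≤ A ^ 2 * (A ^ 2 * t ^ 2 / 2 * Real.cosh (a i * t)) :=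
        mul_le_mul (hA2 i hi) h1 (by linarith) (sq_nonneg _)
  have hEF0 : 0 ≤ E - F := by
    rw [hEdef, hFdef, ← Finset.sum_sub_distrib]
    refine Finset.sum_nonneg fun i _ => ?_
    nlinarith [Real.one_le_cosh (a i * t), sq_nonneg (a i)]
  have hF0 : 0 ≤ F := Finset.sum_nonneg fun i _ => sq_nonneg _
  have hFN : F / s.card ≤ A ^ 2 := by
    rw [div_le_iff₀ hN]
    have h := Finset.sum_le_sum hA2
    simp only [Finset.sum_const, nsmul_eq_mul] at h
    linarith
  have hdec : E / C - F / s.card = (E - F) / C - F / s.card * ((C - s.card) / C) := by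
    field_simp
    ring
  have b1 : (E - F) / C ≤ A ^ 4 * t ^ 2 / 2 := by
    rw [div_le_iff₀ hC]; linarith
  have b10 : 0 ≤ (E - F) / C := by positivity
  have b2 : (C - s.card) / C ≤ A ^ 2 * t ^ 2 / 2 := by
    rw [div_le_iff₀ hC]; linarith
  have b20 : 0 ≤ (C - s.card) / C := by positivity
  have b3 : F / s.card * ((C - s.card) / C) ≤ A ^ 4 * t ^ 2 / 2 := by
    calc _ ≤ A ^ 2 * (A ^ 2 * t ^ 2 / 2) := by gcongr
      _ = _ := by ring
  have b30 : 0 ≤ F / s.card * ((C - s.card) / C) := by positivity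
  have hD0 := sq_nonneg (D / C)
  rw [coshSumVar, abs_le]
  constructor <;> linarith

end CoshSum

/-- The deviations `(j - ν / 2) log p` from the mean of `log d` for `d = p ^ j`, `0 ≤ j ≤ ν`. -/
def centeredLog (n p : ℕ) (j : ℕ) : ℝ := ((j : ℝ) - n.factorization p / 2) * Real.log p

lemma sum_range_sub_sq (s : ℝ) (m : ℕ) :
    ∑ j ∈ Finset.range m, ((j : ℝ) - s) ^ 2 =
      ((m : ℝ) - 1) * m * (2 * m - 1) / 6 - s * m * (m - 1) + m * s ^ 2 := by
  induction m with
  | zero => simp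
  | succ k ih => rw [Finset.sum_range_succ, ih]; push_cast; ring

lemma sum_centeredLog_sq (n p : ℕ) :
    (∑ j ∈ Finset.range (n.factorization p + 1), centeredLog n p j ^ 2) /
        (Finset.range (n.factorization p + 1)).card =
      1 / 12 * ((n.factorization p : ℝ) * ((n.factorization p : ℝ) + 2) * Real.log p ^ 2) := by
  simp only [centeredLog, mul_pow]
  rw [← Finset.sum_mul, sum_range_sub_sq, Finset.card_range]
  have : ((n.factorization p : ℝ) + 1) ≠ 0 := by positivity
  push_cast
  field_simp
  ring

lemma abs_centeredLog_le (n p j : ℕ) (hj : j ∈ Finset.range (n.factorization p + 1)) :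
    |centeredLog n p j| ≤ n.factorization p / 2 * Real.log p := by
  have hL : 0 ≤ Real.log p := Real.log_natCast_nonneg p
  rw [centeredLog, abs_mul, abs_of_nonneg hL]
  have h : (j : ℝ) ≤ n.factorization p := by
    exact_mod_cast Nat.lt_succ_iff.1 (Finset.mem_range.1 hj)
  have h0 : (0 : ℝ) ≤ j := j.cast_nonneg
  gcongr
  rw [abs_le]
  constructor <;> linarith

lemma sum_rpow_eq_exp_mul_sum_cosh {n p : ℕ} (hp : 0 < p) (β : ℝ) :
    ∑ j ∈ Finset.range (n.factorization p + 1), (p : ℝ) ^ ((j : ℝ) * β) =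
      Real.exp (n.factorization p * Real.log p / 2 * β) *
        ∑ j ∈ Finset.range (n.factorization p + 1), Real.cosh (centeredLog n p j * β) := by
  have hp' : (0 : ℝ) < p := by exact_mod_cast hp
  have h1 : ∑ j ∈ Finset.range (n.factorization p + 1), Real.exp (centeredLog n p j * β) =
      ∑ j ∈ Finset.range (n.factorization p + 1), Real.exp (-(centeredLog n p j * β)) := by
    rw [← Finset.sum_range_reflect]
    refine Finset.sum_congr rfl fun j hj => ?_
    have hj' : j ≤ n.factorization p := Nat.lt_succ_iff.1 (Finset.mem_range.1 hj)
    congr 1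
    rw [centeredLog, centeredLog, Nat.add_sub_cancel, Nat.cast_sub hj']
    ring
  have h2 : ∑ j ∈ Finset.range (n.factorization p + 1), Real.cosh (centeredLog n p j * β) =
      ∑ j ∈ Finset.range (n.factorization p + 1), Real.exp (centeredLog n p j * β) := by
    simp only [Real.cosh_eq]
    rw [← Finset.sum_div, Finset.sum_add_distrib, ← h1]
    ring
  rw [h2, Finset.mul_sum]
  refine Finset.sum_congr rfl fun j _ => ?_
  rw [← Real.exp_add, Real.rpow_def_of_pos hp', centeredLog]
  congr 1
  ring

lemma phiN_eq_sum (n : ℕ) (β : ℝ) :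
    phiN n β = ∑ p ∈ n.primeFactors, ((n.factorization p * Real.log p / 2) * β +
      Real.log (∑ j ∈ Finset.range (n.factorization p + 1), Real.cosh (centeredLog n p j * β)) -
      Real.log ((n.factorization p : ℝ) + 1)) := by
  have hC : ∀ p, (∑ j ∈ Finset.range (n.factorization p + 1),
      Real.cosh (centeredLog n p j * β)) ≠ 0 :=
    fun p => (sum_cosh_pos _ Finset.nonempty_range_add_one β).ne'
  have hN : ∀ p, (n.factorization p : ℝ) + 1 ≠ 0 := fun p => by positivity
  have hZ : ∀ p ∈ n.primeFactors,
      (∑ j ∈ Finset.range (n.factorization p + 1), (p : ℝ) ^ ((j : ℝ) * β)) =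
        Real.exp (n.factorization p * Real.log p / 2 * β) *
          ∑ j ∈ Finset.range (n.factorization p + 1), Real.cosh (centeredLog n p j * β) :=
    fun p hp => sum_rpow_eq_exp_mul_sum_cosh (Nat.prime_of_mem_primeFactors hp).pos β
  rw [phiN, ZnR, Real.log_prod]
  · refine Finset.sum_congr rfl fun p hp => ?_
    rw [hZ p hp, Real.log_div (mul_ne_zero (Real.exp_ne_zero _) (hC p)) (hN p),
      Real.log_mul (Real.exp_ne_zero _) (hC p), Real.log_exp]
  · intro p hp
    rw [hZ p hp]
    exact div_ne_zero (mul_ne_zero (Real.exp_ne_zero _) (hC p)) (hN p)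

lemma deriv_phiN (n : ℕ) :
    deriv (phiN n) = fun β => ∑ p ∈ n.primeFactors, (n.factorization p * Real.log p / 2 +
      (∑ j ∈ Finset.range (n.factorization p + 1),
        centeredLog n p j * Real.sinh (centeredLog n p j * β)) /
      ∑ j ∈ Finset.range (n.factorization p + 1), Real.cosh (centeredLog n p j * β)) := by
  ext β
  rw [funext (phiN_eq_sum n)]
  refine (HasDerivAt.fun_sum fun p _ => ?_).deriv
  have h := ((hasDerivAt_id β).const_mul (n.factorization p * Real.log p / 2)).add
    (hasDerivAt_log_sum_cosh (centeredLog n p)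
      (Finset.nonempty_range_add_one (n := n.factorization p)) β)
  simpa using h.sub_const (Real.log ((n.factorization p : ℝ) + 1))

lemma hasDerivAt_deriv_phiN (n : ℕ) (β : ℝ) :
    HasDerivAt (deriv (phiN n)) (∑ p ∈ n.primeFactors,
      coshSumVar (Finset.range (n.factorization p + 1)) (centeredLog n p) β) β := by
  rw [deriv_phiN]
  exact HasDerivAt.fun_sum fun p _ =>
    (hasDerivAt_sinh_div_cosh _ Finset.nonempty_range_add_one β).const_add _

lemma iteratedDeriv_two_phiN (n : ℕ) (β : ℝ) :
    iteratedDeriv 2 (phiN n) β = ∑ p ∈ n.primeFactors,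
      coshSumVar (Finset.range (n.factorization p + 1)) (centeredLog n p) β := by
  rw [iteratedDeriv_succ, iteratedDeriv_one]
  exact (hasDerivAt_deriv_phiN n β).deriv

lemma deriv_phiN_zero (n : ℕ) : deriv (phiN n) 0 = 1 / 2 * Real.log n := by
  rw [deriv_phiN, Real.log_nat_eq_sum_factorization, Finsupp.sum, Nat.support_factorization,
    Finset.mul_sum]
  refine Finset.sum_congr rfl fun p _ => ?_
  simp
  ring

lemma monotone_deriv_phiN (n : ℕ) : Monotone (deriv (phiN n)) := by
  refine monotone_of_deriv_nonneg (fun β => (hasDerivAt_deriv_phiN n β).differentiableAt)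
    fun β => ?_
  rw [(hasDerivAt_deriv_phiN n β).deriv]
  exact Finset.sum_nonneg fun p _ => coshSumVar_nonneg _ Finset.nonempty_range_add_one β

lemma abs_iteratedDeriv_two_phiN_sub_le (n : ℕ) (β : ℝ) :
    |iteratedDeriv 2 (phiN n) β - m2 n| ≤ 30 * m4 n * β ^ 2 := by
  rw [iteratedDeriv_two_phiN, m2, m4, Finset.mul_sum, ← Finset.sum_sub_distrib, ← mul_assoc,
    Finset.mul_sum, Finset.sum_mul]
  refine (Finset.abs_sum_le_sum_abs _ _).trans (Finset.sum_le_sum fun p hp => ?_)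
  have h := abs_coshSumVar_sub_le (centeredLog n p)
    (Finset.nonempty_range_add_one (n := n.factorization p)) (abs_centeredLog_le n p) β
  rw [sum_centeredLog_sq] at h
  refine h.trans ?_
  have hν : (1 : ℝ) ≤ n.factorization p := by
    exact_mod_cast Nat.one_le_iff_ne_zero.2 (Finsupp.mem_support_iff.1
      (by rwa [Nat.support_factorization]))
  set v : ℝ := (n.factorization p : ℝ)
  have h4 : v ^ 4 ≤ v * (v + 2) * (3 * v ^ 2 + 6 * v - 4) := by
    have h1 : v ^ 2 ≤ v * (v + 2) := by nlinarith
    have h2 : v ^ 2 ≤ 3 * v ^ 2 + 6 * v - 4 := by nlinarith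
    calc v ^ 4 = v ^ 2 * v ^ 2 := by ring
      _ ≤ _ := by gcongr
  calc 2 * (v / 2 * Real.log p) ^ 4 * β ^ 2 = 1 / 8 * (v ^ 4 * Real.log p ^ 4) * β ^ 2 := by ring
    _ ≤ 1 / 8 * (v * (v + 2) * (3 * v ^ 2 + 6 * v - 4) * Real.log p ^ 4) * β ^ 2 := by gcongr
    _ = _ := by ring

lemma m4_term_pos {n p : ℕ} (hp : p ∈ n.primeFactors) :
    0 < (n.factorization p : ℝ) * ((n.factorization p : ℝ) + 2) *
      (3 * (n.factorization p : ℝ) ^ 2 + 6 * (n.factorization p : ℝ) - 4) * Real.log p ^ 4 := by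
  have hν : (1 : ℝ) ≤ n.factorization p := by
    exact_mod_cast Nat.one_le_iff_ne_zero.2 (Finsupp.mem_support_iff.1
      (by rwa [Nat.support_factorization]))
  have hL : 0 < Real.log p :=
    Real.log_pos (by exact_mod_cast (Nat.prime_of_mem_primeFactors hp).one_lt)
  have h2 : 0 < 3 * (n.factorization p : ℝ) ^ 2 + 6 * (n.factorization p : ℝ) - 4 := by nlinarith
  positivity

lemma m4_pos {n : ℕ} (hn : 1 < n) : 0 < m4 n :=
  mul_pos (by norm_num) (Finset.sum_pos (fun _ hp => m4_term_pos hp)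
    (Nat.nonempty_primeFactors.2 hn))

lemma m2_pos {n : ℕ} (hn : 1 < n) : 0 < m2 n := by
  refine mul_pos (by norm_num) (Finset.sum_pos (fun p hp => ?_) (Nat.nonempty_primeFactors.2 hn))
  have hν : (0 : ℝ) < n.factorization p := by
    exact_mod_cast Nat.pos_of_ne_zero (Finsupp.mem_support_iff.1
      (by rwa [Nat.support_factorization]))
  have hL : 0 < Real.log p :=
    Real.log_pos (by exact_mod_cast (Nat.prime_of_mem_primeFactors hp).one_lt)
  positivity

lemma abs_deriv_phiN_sub_le {n : ℕ} (hn : 1 < n) {b : ℝ} (hb : 0 ≤ b) :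
    |deriv (phiN n) b - 1 / 2 * Real.log n - m2 n * b| ≤ 30 * m4 n * b ^ 3 := by
  have hd : ∀ t : ℝ, HasDerivAt (fun t => deriv (phiN n) t - m2 n * t)
      (iteratedDeriv 2 (phiN n) t - m2 n) t := fun t => by
    rw [iteratedDeriv_two_phiN]
    exact ((hasDerivAt_deriv_phiN n t).sub ((hasDerivAt_id t).const_mul (m2 n))).congr_deriv
      (by simp)
  have hm4 := m4_pos hn
  have h := Convex.norm_image_sub_le_of_norm_hasDerivWithin_le (C := 30 * m4 n * b ^ 2)
    (fun t (_ : t ∈ Set.Icc 0 b) => (hd t).hasDerivWithinAt)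
    (fun t ht => (abs_iteratedDeriv_two_phiN_sub_le n t).trans (by
      have h0 := ht.1
      have h1 := ht.2
      gcongr)) (convex_Icc 0 b) (Set.left_mem_Icc.2 hb) (Set.right_mem_Icc.2 hb)
  rw [Real.norm_eq_abs, Real.norm_eq_abs, deriv_phiN_zero, sub_zero, abs_of_nonneg hb] at h
  convert h using 1
  · congr 1; ring
  · ring

lemma le_two_mul_div_of_deriv_phiN_eq {n : ℕ} (hn : 1 < n) {b z : ℝ} (hb : 0 ≤ b)
    (hz : 240 * z ^ 2 * m4 n < m2 n ^ 2)
    (hbz : deriv (phiN n) b = 1 / 2 * Real.log n + z * sigman n) :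
    b ≤ 2 * (z / sigman n) := by
  have h2 := m2_pos hn
  have h4 := m4_pos hn
  have hσ : 0 < sigman n := Real.sqrt_pos.2 h2
  have hσ2 : sigman n ^ 2 = m2 n := Real.sq_sqrt h2.le
  set σ := sigman n
  have key : ∀ t, 0 ≤ t → t ≤ b → 60 * m4 n * t ^ 2 ≤ m2 n → t ≤ 2 * (z / σ) := by
    intro t ht htb htm
    have h1 := (abs_le.1 (abs_deriv_phiN_sub_le hn ht)).1
    have h3 := monotone_deriv_phiN n htb
    have h5 : m2 n * t - 30 * m4 n * t ^ 3 ≤ z * σ := by linarith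
    have h6 : 30 * m4 n * t ^ 3 ≤ m2 n * t / 2 := by nlinarith
    have h7 : σ ^ 2 * t ≤ 2 * (z * σ) := by rw [hσ2]; linarith
    have h8 : σ * t ≤ 2 * z := le_of_mul_le_mul_left (by linarith) hσ
    rw [← mul_div_assoc, le_div_iff₀ hσ]
    linarith
  set B := Real.sqrt (m2 n / (60 * m4 n))
  have hB : 60 * m4 n * B ^ 2 = m2 n := by
    rw [Real.sq_sqrt (by positivity)]
    field_simp
  have hB0 : 0 < B := Real.sqrt_pos.2 (by positivity)
  rcases le_total b B with h | h
  · refine key b hb le_rfl ?_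
    rw [← hB]
    gcongr
  · exfalso
    have hle := key B hB0.le h hB.le
    have hsq := pow_le_pow_left₀ hB0.le hle 2
    rw [mul_pow, div_pow, hσ2] at hsq
    have : m2 n ≤ 60 * m4 n * (2 ^ 2 * (z ^ 2 / m2 n)) := hB.ge.trans (by gcongr)
    rw [show 60 * m4 n * (2 ^ 2 * (z ^ 2 / m2 n)) = 240 * z ^ 2 * m4 n / m2 n by ring,
      le_div_iff₀ h2] at this
    nlinarith

lemma saddle_estimates {n : ℕ} (hn : 1 < n) {b z : ℝ} (hb : 0 ≤ b)
    (hz : 240 * z ^ 2 * m4 n < m2 n ^ 2)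
    (hbz : deriv (phiN n) b = 1 / 2 * Real.log n + z * sigman n) :
    |b - z / sigman n| ≤ 240 * (z / sigman n) * z ^ 2 / wn n ∧
      |iteratedDeriv 2 (phiN n) b - sigman n ^ 2| ≤ 240 * sigman n ^ 2 * z ^ 2 / wn n := by
  have hle := le_two_mul_div_of_deriv_phiN_eq hn hb hz hbz
  have h2 := m2_pos hn
  have h4 := m4_pos hn
  have hσ : 0 < sigman n := Real.sqrt_pos.2 h2
  have hσ2 : m2 n = sigman n ^ 2 := (Real.sq_sqrt h2.le).symm
  have hd := abs_deriv_phiN_sub_le hn hb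
  have hi := abs_iteratedDeriv_two_phiN_sub_le n b
  rw [wn, if_neg hn.ne']
  rw [hbz, hσ2] at hd
  rw [hσ2] at hi ⊢
  set σ := sigman n
  constructor
  · have e : 1 / 2 * Real.log n + z * σ - 1 / 2 * Real.log n - σ ^ 2 * b =
        -(σ ^ 2 * (b - z / σ)) := by field_simp; ring
    rw [e, abs_neg, abs_mul, abs_of_pos (by positivity : 0 < σ ^ 2)] at hd
    have h3 : σ ^ 2 * |b - z / σ| ≤ 30 * m4 n * (2 * (z / σ)) ^ 3 := hd.trans (by gcongr)
    have h5 : σ ^ 2 * |b - z / σ| ≤ σ ^ 2 * (240 * (z / σ) * z ^ 2 / ((σ ^ 2) ^ 2 / m4 n)) := by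
      refine h3.trans (le_of_eq ?_)
      field_simp
      ring
    exact le_of_mul_le_mul_left h5 (by positivity)
  · refine hi.trans ?_
    calc 30 * m4 n * b ^ 2 ≤ 30 * m4 n * (2 * (z / σ)) ^ 2 := by gcongr
      _ = 120 * (σ ^ 2 * z ^ 2 / ((σ ^ 2) ^ 2 / m4 n)) := by field_simp; ring
      _ ≤ 240 * (σ ^ 2 * z ^ 2 / ((σ ^ 2) ^ 2 / m4 n)) := by gcongr; norm_num
      _ = _ := by ring

/-- **Lemma 4.4**: precise estimates for `β_n(z)` and `φ_n''(β_n(z))`. -/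
theorem stmt15 :
    ∀ κ₁ κ₂ : ℝ, 0 < κ₁ → 0 < κ₂ → κ₂ < 1 →
      ∃ c > (0:ℝ), ∃ C > (0:ℝ),
        ∀ x y : ℝ, 2 ≤ y → y ≤ x → ∀ n : ℕ, n ∈ Sf x y → Real.sqrt x ≤ (n : ℝ) →
          κ₁ * ubar x y ≤ (omegaTilde x y n : ℝ) →
          κ₂ ≤ m2 n * ubar x y / Real.log x ^ 2 →
          m2 n * ubar x y / Real.log x ^ 2 ≤ 1 / κ₂ →
          κ₂ / ubar x y ≤ m4 n * ubar x y ^ 3 / Real.log x ^ 4 →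
          m4 n * ubar x y ^ 3 / Real.log x ^ 4 ≤ 1 / κ₂ →
          ∀ βf : ℝ → ℝ,
            (∀ z ∈ Set.Ico (0:ℝ) (Real.log n / (2 * sigman n)),
              0 ≤ βf z ∧
                deriv (phiN n) (βf z) = (1/2) * Real.log n + z * sigman n) →
            ∀ z : ℝ, 0 ≤ z → z ≤ c * Real.sqrt (ubar x y) →
              |βf z - z / sigman n| ≤ C * (z / sigman n) * z ^ 2 / wn n ∧
              |iteratedDeriv 2 (phiN n) (βf z) - sigman n ^ 2| ≤
                C * sigman n ^ 2 * z ^ 2 / wn n := by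
  intro κ₁ κ₂ _ hκ hκ1
  refine ⟨κ₂ ^ 2 / 16, by positivity, 240, by norm_num, ?_⟩
  intro x y hy hyx n _ hxn _ hm2l hm2u _ hm4u βf hβ z hz0 hzc
  have hx1 : 1 < x := by linarith
  have hn : 1 < n := by
    have h : 1 < Real.sqrt x := Real.lt_sqrt_of_sq_lt (by linarith)
    exact_mod_cast h.trans_le hxn
  have h2 := m2_pos hn
  have h4 := m4_pos hn
  have hL : 0 < Real.log x := Real.log_pos hx1
  have hLn : Real.log x / 2 ≤ Real.log n := by
    rw [← Real.log_sqrt (by linarith)]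
    exact Real.log_le_log (Real.sqrt_pos.2 (by linarith)) hxn
  rw [le_div_iff₀ (by positivity)] at hm2l
  rw [div_le_div_iff₀ (by positivity) hκ] at hm2u hm4u
  set U := ubar x y
  set L := Real.log x
  have hU : 0 < U := pos_of_mul_pos_right (lt_of_lt_of_le (by positivity) hm2l) h2.le
  have hσ : 0 < sigman n := Real.sqrt_pos.2 h2
  have hσ2 : sigman n ^ 2 = m2 n := Real.sq_sqrt h2.le
  have hz2 : z ^ 2 ≤ κ₂ ^ 4 / 256 * U := by
    refine (pow_le_pow_left₀ hz0 hzc 2).trans (le_of_eq ?_)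
    rw [mul_pow, Real.sq_sqrt hU.le]
    ring
  have hdom : z < Real.log n / (2 * sigman n) := by
    rw [lt_div_iff₀ (by positivity)]
    refine lt_of_lt_of_le ?_ hLn
    refine lt_of_pow_lt_pow_left₀ 2 (by positivity) ?_
    have hκ3 : κ₂ ^ 3 < 1 := pow_lt_one₀ hκ.le hκ1 (by norm_num)
    calc (z * (2 * sigman n)) ^ 2 = 4 * z ^ 2 * m2 n := by rw [← hσ2]; ring
      _ ≤ 4 * (κ₂ ^ 4 / 256 * U) * m2 n := by gcongr
      _ = κ₂ ^ 3 / 64 * (m2 n * U * κ₂) := by ring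
      _ ≤ κ₂ ^ 3 / 64 * (1 * L ^ 2) := by gcongr
      _ < (L / 2) ^ 2 := by nlinarith [sq_pos_of_pos hL]
  have hsmall : 240 * z ^ 2 * m4 n < m2 n ^ 2 := by
    refine lt_of_mul_lt_mul_right ?_ (sq_nonneg U)
    calc 240 * z ^ 2 * m4 n * U ^ 2 ≤ 240 * (κ₂ ^ 4 / 256 * U) * m4 n * U ^ 2 := by gcongr
      _ = 240 / 256 * κ₂ ^ 3 * (m4 n * U ^ 3 * κ₂) := by ring
      _ ≤ 240 / 256 * κ₂ ^ 3 * (1 * L ^ 4) := by gcongr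
      _ < κ₂ ^ 2 * L ^ 4 := by
        have : 0 < κ₂ ^ 2 * L ^ 4 := by positivity
        nlinarith
      _ = (κ₂ * L ^ 2) ^ 2 := by ring
      _ ≤ (m2 n * U) ^ 2 := by gcongr
      _ = m2 n ^ 2 * U ^ 2 := by ring
  obtain ⟨hb, hbz⟩ := hβ z ⟨hz0, hdom⟩
  exact saddle_estimates hn hb hsmall hbz

end
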